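/- arXiv:2108.01503 — 5 statements merged into one kernel-verified Lean document; each statement's English description precedes it below -/
import Mathlib

section
/- A session type T is fairly terminating if and only if T ∈ Gen(I_T, Ico_T), where (I_T, Ico_T) is the generalized inference system for fair termination. -/
/-- An inference system over a universe `U`: a set of rules `(premises, conclusion)`. -/
abbrev InfSys (U : Type) := Set (Set U × U)

/-- The (monotone) inference operator associated with an inference system. -/
def infOp {U : Type} (I : InfSys U) : Set U →o Set U where
  toFun X := {j | ∃ pr, pr ⊆ X ∧ (pr, j) ∈ I}
  monotone' := by
    intro X Y h j hj
    obtain ⟨pr, hpr, hr⟩ := hj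
    exact ⟨pr, hpr.trans h, hr⟩

/-- Inductive interpretation: least fixed point of the inference operator. -/
def Ind {U : Type} (I : InfSys U) : Set U := OrderHom.lfp (infOp I)

/-- Coinductive interpretation: greatest fixed point of the inference operator. -/
def CoInd {U : Type} (I : InfSys U) : Set U := OrderHom.gfp (infOp I)

/-- Interpretation of a generalized inference system `(I, Ico)`: the greatest
post-fixed point of `infOp I` included in `Ind (I ∪ Ico)`, i.e. the union of
all `X` with `X ⊆ infOp I X` and `X ⊆ Ind (I ∪ Ico)`. -/
def Gen {U : Type} (I Ico : InfSys U) : Set U :=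
  sSup {X | X ⊆ infOp I X ∧ X ⊆ Ind (I ∪ Ico)}

/-- Tags for the three constructors of session types. -/
inductive STag : Type | nil | inp | out

/-- The polynomial functor `X ↦ Unit ⊕ (V → X) ⊕ (V → X)`. -/
def STF (V : Type) : PFunctor.{0} := ⟨STag, fun t => match t with
  | .nil => Empty
  | .inp => V
  | .out => V⟩

/-- Session types over `V`: the final coalgebra (M-type) of `STF V`. -/
def SessionType (V : Type) : Type := (STF V).M

/-- The `nil` session type. -/
def SessionType.nil (V : Type) : SessionType V := PFunctor.M.mk ⟨STag.nil, Empty.elim⟩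

/-- Input session type. -/
def SessionType.inp {V : Type} (f : V → SessionType V) : SessionType V :=
  PFunctor.M.mk ⟨STag.inp, f⟩

/-- Output session type. -/
def SessionType.out {V : Type} (f : V → SessionType V) : SessionType V :=
  PFunctor.M.mk ⟨STag.out, f⟩

/-- Input/output actions `?x` and `!x`. -/
inductive Act (V : Type) : Type
  | inp (x : V)
  | out (x : V)

/-- Labeled transitions of session types:
`inp f −?x→ f x` for every `x`, and `out f −!x→ f x` for every `x ∈ dom f`. -/
inductive Transition {V : Type} : SessionType V → Act V → SessionType V → Prop
  | inp (f : V → SessionType V) (x : V) : Transition (.inp f) (.inp x) (f x)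
  | out (f : V → SessionType V) (x : V) :
      f x ≠ SessionType.nil V → Transition (.out f) (.out x) (f x)

/-- `TransSeq T φ S` means `T ⇒φ S` (composite of transitions along `φ`). -/
inductive TransSeq {V : Type} : SessionType V → List (Act V) → SessionType V → Prop
  | refl (T : SessionType V) : TransSeq T [] T
  | step {T T' S : SessionType V} {α : Act V} {φ : List (Act V)} :
      Transition T α T' → TransSeq T' φ S → TransSeq T (α :: φ) S

/-- Traces of a session type: `{φ | ∃ S ≠ nil, T ⇒φ S}`. -/
def Traces {V : Type} (T : SessionType V) : Set (List (Act V)) :=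
  {φ | ∃ S, S ≠ SessionType.nil V ∧ TransSeq T φ S}

/-- Fair termination: each trace extends to a maximal one. -/
def FairlyTerminating {V : Type} (T : SessionType V) : Prop :=
  ∀ φ ∈ Traces T, ∃ ψ, (φ ++ ψ) ∈ Traces T ∧ ∀ χ, ((φ ++ ψ) ++ χ) ∈ Traces T → χ = []

/-- Rules `I_T` for fair termination (t-nil and t-all). -/
def IT (V : Type) : InfSys (SessionType V) :=
  {r | r = (∅, SessionType.nil V)} ∪
  {r | ∃ f, r = (Set.range f, SessionType.inp f)} ∪
  {r | ∃ f, r = (Set.range f, SessionType.out f)}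

/-- Corules `Ico_T` for fair termination (t-any). -/
def IcoT (V : Type) : InfSys (SessionType V) :=
  {r | ∃ f x, f x ≠ SessionType.nil V ∧ r = ({f x}, SessionType.inp f)} ∪
  {r | ∃ f x, f x ≠ SessionType.nil V ∧ r = ({f x}, SessionType.out f)}

namespace SessionType

variable {V : Type}

/-- `T` is an input or output type with continuation `f`. -/
def HasCont (T : SessionType V) (f : V → SessionType V) : Prop :=
  T = .inp f ∨ T = .out f

theorem inp_ne_nil (f : V → SessionType V) : SessionType.inp f ≠ .nil V := by
  intro h
  have h' := PFunctor.M.mk_inj h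
  cases h'

theorem out_ne_nil (f : V → SessionType V) : SessionType.out f ≠ .nil V := by
  intro h
  have h' := PFunctor.M.mk_inj h
  cases h'

theorem inp_ne_out (f g : V → SessionType V) : SessionType.inp f ≠ .out g := by
  intro h
  have h' := PFunctor.M.mk_inj h
  cases h'

theorem inp_injective : Function.Injective (SessionType.inp (V := V)) := by
  intro f g h
  have h' := PFunctor.M.mk_inj h
  cases h'
  rfl

theorem out_injective : Function.Injective (SessionType.out (V := V)) := by
  intro f g h
  have h' := PFunctor.M.mk_inj h
  cases h'
  rfl

theorem eq_nil_or_hasCont (T : SessionType V) : T = .nil V ∨ ∃ f, T.HasCont f := by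
  rw [← PFunctor.M.mk_dest T]
  rcases PFunctor.M.dest T with ⟨_ | _ | _, f⟩
  · left
    unfold SessionType.nil
    congr
    funext x
    exact x.elim
  · exact .inr ⟨f, .inl rfl⟩
  · exact .inr ⟨f, .inr rfl⟩

theorem HasCont.ne_nil {T : SessionType V} {f : V → SessionType V} (h : T.HasCont f) :
    T ≠ .nil V := by
  rcases h with rfl | rfl
  · exact inp_ne_nil f
  · exact out_ne_nil f

theorem HasCont.unique {T : SessionType V} {f g : V → SessionType V} (hf : T.HasCont f)
    (hg : T.HasCont g) : f = g := by
  rcases hf with rfl | rfl <;> rcases hg with h | h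
  · exact inp_injective h
  · exact (inp_ne_out _ _ h).elim
  · exact (inp_ne_out _ _ h.symm).elim
  · exact out_injective h

theorem HasCont.exists_transition {T : SessionType V} {f : V → SessionType V} (h : T.HasCont f)
    {x : V} (hx : f x ≠ .nil V) : ∃ α, Transition T α (f x) := by
  rcases h with rfl | rfl
  · exact ⟨_, .inp f x⟩
  · exact ⟨_, .out f x hx⟩

/-- Some trace of `T` is maximal. -/
def HasMaximalTrace (T : SessionType V) : Prop :=
  ∃ ψ ∈ Traces T, ∀ χ, ψ ++ χ ∈ Traces T → χ = []

end SessionType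

open SessionType

section Transitions

variable {V : Type} {T S : SessionType V}

theorem Transition.exists_hasCont {α : Act V} (h : Transition T α S) :
    ∃ f x, T.HasCont f ∧ S = f x := by
  cases h with
  | inp f x => exact ⟨f, x, .inl rfl, rfl⟩
  | out f x _ => exact ⟨f, x, .inr rfl, rfl⟩

theorem Transition.deterministic {α : Act V} {S' : SessionType V} (h : Transition T α S)
    (h' : Transition T α S') : S = S' := by
  cases α with
  | inp x =>
    generalize hT : T = T' at h'
    cases h
    cases h'
    rw [inp_injective hT]
  | out x =>
    generalize hT : T = T' at h'
    cases h
    cases h'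
    rw [out_injective hT]

theorem Transition.ne_nil {α : Act V} (h : Transition T α S) : T ≠ .nil V := by
  obtain ⟨f, x, hf, -⟩ := h.exists_hasCont
  exact hf.ne_nil

theorem Transition.cons_mem_traces {α : Act V} (h : Transition T α S) (ψ : List (Act V)) :
    α :: ψ ∈ Traces T ↔ ψ ∈ Traces S := by
  constructor
  · rintro ⟨R, hR, _ | ⟨hstep, hseq⟩⟩
    rw [h.deterministic hstep]
    exact ⟨R, hR, hseq⟩
  · rintro ⟨R, hR, hseq⟩
    exact ⟨R, hR, .step h hseq⟩

theorem TransSeq.append_mem_traces {φ : List (Act V)} (h : TransSeq T φ S) (ψ : List (Act V)) :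
    φ ++ ψ ∈ Traces T ↔ ψ ∈ Traces S := by
  induction h with
  | refl => rfl
  | step hstep _ ih => exact (hstep.cons_mem_traces _).trans ih

theorem TransSeq.ne_nil {φ : List (Act V)} (h : TransSeq T φ S) (hS : S ≠ .nil V) :
    T ≠ .nil V := by
  cases h with
  | refl => exact hS
  | step hstep _ => exact hstep.ne_nil

theorem fairlyTerminating_iff_forall_transSeq :
    FairlyTerminating T ↔ ∀ φ S, S ≠ .nil V → TransSeq T φ S → S.HasMaximalTrace := by
  have key {φ : List (Act V)} {S : SessionType V} (h : TransSeq T φ S) :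
      (∃ ψ, φ ++ ψ ∈ Traces T ∧ ∀ χ, (φ ++ ψ) ++ χ ∈ Traces T → χ = []) ↔
        S.HasMaximalTrace := by
    simp only [List.append_assoc, h.append_mem_traces, HasMaximalTrace]
  constructor
  · intro hT φ S hS h
    exact (key h).1 (hT φ ⟨S, hS, h⟩)
  · rintro hT φ ⟨S, hS, h⟩
    exact (key h).2 (hT φ S hS h)

theorem FairlyTerminating.nil : FairlyTerminating (SessionType.nil V) := by
  rintro φ ⟨S, hS, h⟩
  exact (h.ne_nil hS rfl).elim

theorem FairlyTerminating.cont {f : V → SessionType V} (hT : FairlyTerminating T)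
    (hf : T.HasCont f) (x : V) : FairlyTerminating (f x) := by
  by_cases hx : f x = .nil V
  · rw [hx]
    exact .nil
  · obtain ⟨α, hα⟩ := hf.exists_transition hx
    rw [fairlyTerminating_iff_forall_transSeq] at hT ⊢
    exact fun φ S hS h => hT (α :: φ) S hS (.step hα h)

theorem SessionType.HasMaximalTrace.of_transition {α : Act V} (h : Transition T α S)
    (hS : S.HasMaximalTrace) : T.HasMaximalTrace := by
  obtain ⟨ψ, hψ, hmax⟩ := hS
  exact ⟨α :: ψ, (h.cons_mem_traces ψ).2 hψ, fun χ hχ => hmax χ ((h.cons_mem_traces _).1 hχ)⟩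

theorem SessionType.HasCont.hasMaximalTrace {f : V → SessionType V} (hf : T.HasCont f)
    (hnil : ∀ x, f x = .nil V) : T.HasMaximalTrace := by
  refine ⟨[], ⟨T, hf.ne_nil, .refl T⟩, ?_⟩
  rintro χ ⟨S, hS, _ | ⟨hstep, hseq⟩⟩
  · rfl
  · obtain ⟨g, x, hg, rfl⟩ := hstep.exists_hasCont
    rw [← hf.unique hg] at hseq
    exact (hseq.ne_nil hS (hnil x)).elim

end Transitions

section Inference

variable {V : Type} {T S : SessionType V}

theorem mem_infOp_IT {X : Set (SessionType V)} :
    T ∈ infOp (IT V) X ↔ T = .nil V ∨ ∃ f, T.HasCont f ∧ ∀ x, f x ∈ X := by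
  constructor
  · rintro ⟨pr, hpr, (h | ⟨f, h⟩) | ⟨f, h⟩⟩ <;> cases h
    · exact .inl rfl
    · exact .inr ⟨f, .inl rfl, fun x => hpr ⟨x, rfl⟩⟩
    · exact .inr ⟨f, .inr rfl, fun x => hpr ⟨x, rfl⟩⟩
  · rintro (rfl | ⟨f, rfl | rfl, hf⟩)
    · exact ⟨∅, Set.empty_subset _, .inl (.inl rfl)⟩
    · exact ⟨_, Set.range_subset_iff.2 hf, .inl (.inr ⟨f, rfl⟩)⟩
    · exact ⟨_, Set.range_subset_iff.2 hf, .inr ⟨f, rfl⟩⟩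

theorem mem_infOp_IcoT {X : Set (SessionType V)} :
    T ∈ infOp (IcoT V) X ↔ ∃ f x, T.HasCont f ∧ f x ≠ .nil V ∧ f x ∈ X := by
  constructor
  · rintro ⟨pr, hpr, ⟨f, x, hx, h⟩ | ⟨f, x, hx, h⟩⟩ <;> cases h
    · exact ⟨f, x, .inl rfl, hx, hpr rfl⟩
    · exact ⟨f, x, .inr rfl, hx, hpr rfl⟩
  · rintro ⟨f, x, rfl | rfl, hx, hX⟩
    · exact ⟨_, Set.singleton_subset_iff.2 hX, .inl ⟨f, x, hx, rfl⟩⟩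
    · exact ⟨_, Set.singleton_subset_iff.2 hX, .inr ⟨f, x, hx, rfl⟩⟩

theorem mem_infOp_union {U : Type} {I J : InfSys U} {X : Set U} {j : U} :
    j ∈ infOp (I ∪ J) X ↔ j ∈ infOp I X ∨ j ∈ infOp J X := by
  constructor
  · rintro ⟨pr, hpr, h | h⟩
    · exact .inl ⟨pr, hpr, h⟩
    · exact .inr ⟨pr, hpr, h⟩
  · rintro (⟨pr, hpr, h⟩ | ⟨pr, hpr, h⟩)
    · exact ⟨pr, hpr, .inl h⟩
    · exact ⟨pr, hpr, .inr h⟩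

theorem infOp_Ind {U : Type} (I : InfSys U) : infOp I (Ind I) = Ind I :=
  OrderHom.map_lfp _

theorem Ind_subset {U : Type} {I : InfSys U} {X : Set U} (h : infOp I X ⊆ X) : Ind I ⊆ X :=
  OrderHom.lfp_le _ h

theorem nil_mem_Ind : SessionType.nil V ∈ Ind (IT V ∪ IcoT V) := by
  rw [← infOp_Ind, mem_infOp_union, mem_infOp_IT]
  exact .inl (.inl rfl)

theorem SessionType.HasCont.mem_Ind {f : V → SessionType V} (hf : T.HasCont f)
    (h : ∀ x, f x ∈ Ind (IT V ∪ IcoT V)) : T ∈ Ind (IT V ∪ IcoT V) := by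
  rw [← infOp_Ind, mem_infOp_union, mem_infOp_IT]
  exact .inl (.inr ⟨f, hf, h⟩)

theorem Transition.mem_Ind {α : Act V} (h : Transition T α S) (hS : S ≠ .nil V)
    (hInd : S ∈ Ind (IT V ∪ IcoT V)) : T ∈ Ind (IT V ∪ IcoT V) := by
  obtain ⟨f, x, hf, rfl⟩ := h.exists_hasCont
  rw [← infOp_Ind, mem_infOp_union, mem_infOp_IcoT]
  exact .inr ⟨f, x, hf, hS, hInd⟩

theorem TransSeq.mem_Ind {φ : List (Act V)} (h : TransSeq T φ S) (hS : S ≠ .nil V)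
    (hInd : S ∈ Ind (IT V ∪ IcoT V)) : T ∈ Ind (IT V ∪ IcoT V) := by
  induction h with
  | refl => exact hInd
  | step hstep hseq ih => exact hstep.mem_Ind (hseq.ne_nil hS) (ih hS hInd)

theorem SessionType.HasMaximalTrace.mem_Ind (h : T.HasMaximalTrace) :
    T ∈ Ind (IT V ∪ IcoT V) := by
  obtain ⟨ψ, ⟨S, hS, hseq⟩, hmax⟩ := h
  refine hseq.mem_Ind hS ?_
  obtain rfl | ⟨f, hf⟩ := S.eq_nil_or_hasCont
  · exact nil_mem_Ind
  refine hf.mem_Ind fun x => ?_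
  by_cases hx : f x = .nil V
  · rw [hx]
    exact nil_mem_Ind
  · obtain ⟨α, hα⟩ := hf.exists_transition hx
    have hmem : [α] ∈ Traces S := ⟨f x, hx, .step hα (.refl _)⟩
    cases hmax [α] ((hseq.append_mem_traces _).2 hmem)

theorem hasMaximalTrace_of_mem_Ind (hT : T ∈ Ind (IT V ∪ IcoT V)) :
    T ≠ .nil V → T.HasMaximalTrace := by
  suffices h : Ind (IT V ∪ IcoT V) ⊆ {T | T ≠ .nil V → T.HasMaximalTrace} from h hT
  refine Ind_subset fun S hS hne => ?_
  have hstep {f : V → SessionType V} {x : V} (hf : S.HasCont f) (hx : f x ≠ .nil V)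
      (hmax : f x ≠ .nil V → (f x).HasMaximalTrace) : S.HasMaximalTrace := by
    obtain ⟨α, hα⟩ := hf.exists_transition hx
    exact .of_transition hα (hmax hx)
  rw [mem_infOp_union, mem_infOp_IT, mem_infOp_IcoT] at hS
  obtain (rfl | ⟨f, hf, hX⟩) | ⟨f, x, hf, hx, hX⟩ := hS
  · exact (hne rfl).elim
  · by_cases hnil : ∀ x, f x = .nil V
    · exact hf.hasMaximalTrace hnil
    · obtain ⟨x, hx⟩ := not_forall.1 hnil
      exact hstep hf hx (hX x)
  · exact hstep hf hx hX

theorem FairlyTerminating.mem_Ind (hT : FairlyTerminating T) : T ∈ Ind (IT V ∪ IcoT V) := by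
  by_cases h : T = .nil V
  · rw [h]
    exact nil_mem_Ind
  · exact (fairlyTerminating_iff_forall_transSeq.1 hT [] T h (.refl T)).mem_Ind

theorem TransSeq.mem_of_subset_infOp {X : Set (SessionType V)} (hX : X ⊆ infOp (IT V) X)
    {φ : List (Act V)} (h : TransSeq T φ S) (hT : T ∈ X) : S ∈ X := by
  induction h with
  | refl => exact hT
  | step hstep _ ih =>
    obtain ⟨f, x, hf, rfl⟩ := hstep.exists_hasCont
    obtain rfl | ⟨g, hg, hgX⟩ := mem_infOp_IT.1 (hX hT)
    · exact (hf.ne_nil rfl).elim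
    · rw [hf.unique hg] at ih
      exact ih (hgX x)

end Inference

/-- A session type is fairly terminating iff it belongs to the interpretation of
the generalized inference system for fair termination. -/
theorem stmt3 {V : Type} [Nontrivial V] (T : SessionType V) :
    FairlyTerminating T ↔ T ∈ Gen (IT V) (IcoT V) := by
  constructor
  · intro hT
    refine Set.mem_sUnion.2 ⟨{T | FairlyTerminating T}, ⟨fun S hS => ?_, fun S hS => ?_⟩, hT⟩
    · exact mem_infOp_IT.2 (S.eq_nil_or_hasCont.imp_right fun ⟨f, hf⟩ => ⟨f, hf, hS.cont hf⟩)
    · exact FairlyTerminating.mem_Ind hS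
  · intro hT
    obtain ⟨X, ⟨hpost, hInd⟩, hTX⟩ := Set.mem_sUnion.1 hT
    exact fairlyTerminating_iff_forall_transSeq.2 fun φ S hS h =>
      hasMaximalTrace_of_mem_Ind (hInd (h.mem_of_subset_infOp hpost hTX)) hS
end

section
/- If T ∈ Ind(I_T ∪ Ico_T) and T ≠ nil, then traces(T) contains a maximal trace, i.e. there exists ψ ∈ traces(T) such that ψχ ∈ traces(T) implies χ = ε. -/
/-- `T` has a maximal trace. -/
def HasMaximalTrace {V : Type} (T : SessionType V) : Prop :=
  ∃ ψ ∈ Traces T, ∀ χ, ψ ++ χ ∈ Traces T → χ = []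

theorem SessionType.inp_injective_s7 {V : Type} :
    Function.Injective (SessionType.inp (V := V)) := by
  intro f g h
  have := PFunctor.M.mk_inj h
  cases this
  rfl

theorem SessionType.out_injective_s7 {V : Type} :
    Function.Injective (SessionType.out (V := V)) := by
  intro f g h
  have := PFunctor.M.mk_inj h
  cases this
  rfl

theorem SessionType.inp_ne_nil_s7 {V : Type} (f : V → SessionType V) :
    SessionType.inp f ≠ SessionType.nil V := by
  intro h
  have := congrArg Sigma.fst (PFunctor.M.mk_inj h)
  cases this

theorem SessionType.out_ne_nil_s7 {V : Type} (f : V → SessionType V) :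
    SessionType.out f ≠ SessionType.nil V := by
  intro h
  have := congrArg Sigma.fst (PFunctor.M.mk_inj h)
  cases this

theorem SessionType.inp_ne_out_s7 {V : Type} (f g : V → SessionType V) :
    SessionType.inp f ≠ SessionType.out g := by
  intro h
  have := congrArg Sigma.fst (PFunctor.M.mk_inj h)
  cases this

theorem transition_inp_iff {V : Type} {f : V → SessionType V} {α : Act V} {T : SessionType V} :
    Transition (.inp f) α T ↔ ∃ x, α = .inp x ∧ T = f x := by
  constructor
  · generalize hS : SessionType.inp f = S
    rintro (⟨g, x⟩ | ⟨g, x, -⟩)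
    · obtain rfl := SessionType.inp_injective_s7 hS
      exact ⟨x, rfl, rfl⟩
    · exact absurd hS (SessionType.inp_ne_out_s7 f g)
  · rintro ⟨x, rfl, rfl⟩
    exact .inp f x

theorem transition_out_iff {V : Type} {f : V → SessionType V} {α : Act V} {T : SessionType V} :
    Transition (.out f) α T ↔ ∃ x, f x ≠ SessionType.nil V ∧ α = .out x ∧ T = f x := by
  constructor
  · generalize hS : SessionType.out f = S
    rintro (⟨g, x⟩ | ⟨g, x, hx⟩)
    · exact absurd hS.symm (SessionType.inp_ne_out_s7 g f)
    · obtain rfl := SessionType.out_injective_s7 hS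
      exact ⟨x, hx, rfl, rfl⟩
  · rintro ⟨x, hx, rfl, rfl⟩
    exact .out f x hx

theorem Transition.source_ne_nil {V : Type} {T T' : SessionType V} {α : Act V}
    (h : Transition T α T') : T ≠ SessionType.nil V := by
  cases h with
  | inp f x => exact SessionType.inp_ne_nil_s7 f
  | out f x _ => exact SessionType.out_ne_nil_s7 f

theorem Transition.deterministic_s7 {V : Type} {T T₁ T₂ : SessionType V} {α : Act V}
    (h₁ : Transition T α T₁) (h₂ : Transition T α T₂) : T₁ = T₂ := by
  cases h₁ with
  | inp f x =>
    obtain ⟨y, hy, rfl⟩ := transition_inp_iff.1 h₂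
    cases hy
    rfl
  | out f x _ =>
    obtain ⟨y, _, hy, rfl⟩ := transition_out_iff.1 h₂
    cases hy
    rfl

theorem nil_mem_traces_iff {V : Type} {T : SessionType V} :
    [] ∈ Traces T ↔ T ≠ SessionType.nil V := by
  constructor
  · rintro ⟨S, hS, ⟨⟩⟩
    exact hS
  · exact fun h => ⟨T, h, .refl T⟩

theorem cons_mem_traces_iff {V : Type} {T : SessionType V} {α : Act V} {φ : List (Act V)} :
    α :: φ ∈ Traces T ↔ ∃ T', Transition T α T' ∧ φ ∈ Traces T' := by
  constructor
  · rintro ⟨S, hS, h⟩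
    cases h with
    | step ht hs => exact ⟨_, ht, S, hS, hs⟩
  · rintro ⟨T', ht, S, hS, hs⟩
    exact ⟨S, hS, .step ht hs⟩

theorem ne_nil_of_mem_traces {V : Type} {T : SessionType V} {φ : List (Act V)}
    (h : φ ∈ Traces T) : T ≠ SessionType.nil V := by
  cases φ with
  | nil => exact nil_mem_traces_iff.1 h
  | cons α φ =>
    obtain ⟨T', ht, _⟩ := cons_mem_traces_iff.1 h
    exact ht.source_ne_nil

theorem HasMaximalTrace.of_transition {V : Type} {T T' : SessionType V} {α : Act V}
    (ht : Transition T α T') (h : HasMaximalTrace T') : HasMaximalTrace T := by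
  obtain ⟨ψ, hψ, hmax⟩ := h
  refine ⟨α :: ψ, cons_mem_traces_iff.2 ⟨T', ht, hψ⟩, fun χ hχ => hmax χ ?_⟩
  obtain ⟨T'', ht', hχ'⟩ := cons_mem_traces_iff.1 hχ
  rwa [ht.deterministic_s7 ht']

theorem HasMaximalTrace.of_forall_transition_nil {V : Type} {T : SessionType V}
    (hT : T ≠ SessionType.nil V)
    (h : ∀ α T', Transition T α T' → T' = SessionType.nil V) : HasMaximalTrace T := by
  refine ⟨[], nil_mem_traces_iff.2 hT, fun χ hχ => ?_⟩
  cases χ with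
  | nil => rfl
  | cons α χ =>
    obtain ⟨T', ht, hχ'⟩ := cons_mem_traces_iff.1 hχ
    exact absurd (h α T' ht) (ne_nil_of_mem_traces hχ')

/-- A type all of whose non-`nil` successors have maximal traces has one itself. -/
theorem HasMaximalTrace.of_forall_transition {V : Type} {T : SessionType V}
    (hT : T ≠ SessionType.nil V)
    (h : ∀ α T', Transition T α T' → T' ≠ SessionType.nil V → HasMaximalTrace T') :
    HasMaximalTrace T := by
  by_cases hex : ∃ α T', Transition T α T' ∧ T' ≠ SessionType.nil V
  · obtain ⟨α, T', ht, hne⟩ := hex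
    exact .of_transition ht (h α T' ht hne)
  · push Not at hex
    exact .of_forall_transition_nil hT hex

/-- A non-`nil` session type derivable in `Ind (I_T ∪ Ico_T)` has a maximal trace. -/
theorem stmt7 {V : Type} [Nontrivial V] (T : SessionType V)
    (h : T ∈ Ind (IT V ∪ IcoT V)) (hnil : T ≠ SessionType.nil V) :
    ∃ ψ ∈ Traces T, ∀ χ, ψ ++ χ ∈ Traces T → χ = [] := by
  suffices hle : Ind (IT V ∪ IcoT V) ≤ {S | S ≠ SessionType.nil V → HasMaximalTrace S} from
    hle h hnil
  refine OrderHom.lfp_le _ ?_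
  rintro S ⟨pr, hpr, ((hr | ⟨f, hr⟩) | ⟨f, hr⟩) | (⟨f, x, hx, hr⟩ | ⟨f, x, hx, hr⟩)⟩ hS <;>
    cases hr
  · exact absurd rfl hS
  · refine .of_forall_transition hS fun α T' ht hne => ?_
    obtain ⟨x, _, rfl⟩ := transition_inp_iff.1 ht
    exact hpr ⟨x, rfl⟩ hne
  · refine .of_forall_transition hS fun α T' ht hne => ?_
    obtain ⟨x, _, _, rfl⟩ := transition_out_iff.1 ht
    exact hpr ⟨x, rfl⟩ hne
  · exact .of_transition (.inp f x) (hpr rfl hx)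
  · exact .of_transition (.out f x hx) (hpr rfl hx)
end

section
/- If (R, S) ∈ Ind(I_C ∪ Ico_C), then the session (R, S) may succeed, i.e. there exists a successful (R', S') with (R, S) ⇒ (R', S'). -/
/-- Complementary action. -/
def coAct {V : Type} : Act V → Act V
  | .inp x => .out x
  | .out x => .inp x

/-- Reduction of sessions: client and server synchronize. -/
def Red {V : Type} (p q : SessionType V × SessionType V) : Prop :=
  ∃ α, Transition p.1 (coAct α) q.1 ∧ Transition p.2 α q.2

/-- Reflexive-transitive closure of session reduction. -/
def Reds {V : Type} : SessionType V × SessionType V → SessionType V × SessionType V → Prop :=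
  Relation.ReflTransGen Red

/-- A successful session: the client is `end!` and the server has not failed. -/
def Successful {V : Type} (p : SessionType V × SessionType V) : Prop :=
  (∃ f, p.1 = SessionType.out f ∧ ∀ x, f x = SessionType.nil V) ∧ p.2 ≠ SessionType.nil V

/-- A session may succeed if it reduces to a successful one. -/
def MaySucceed {V : Type} (p : SessionType V × SessionType V) : Prop :=
  ∃ q, Reds p q ∧ Successful q

/-- `R` is compliant with `S`: every stuck reduct is successful. -/
def Compliant {V : Type} (R S : SessionType V) : Prop :=
  ∀ p, Reds (R, S) p → (∀ q, ¬ Red p q) → Successful p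

/-- `R` is fairly compliant with `S`: every reduct may succeed. -/
def FairCompliant {V : Type} (R S : SessionType V) : Prop :=
  ∀ p, Reds (R, S) p → MaySucceed p

/-- Plain rules `I_C` of the fair-compliance GIS (c-success, c-inp-out, c-out-inp). -/
def IC (V : Type) : InfSys (SessionType V × SessionType V) :=
  {r | ∃ (f : V → SessionType V) (S : SessionType V),
        (∀ x, f x = SessionType.nil V) ∧ S ≠ SessionType.nil V ∧
        r = (∅, (SessionType.out f, S))} ∪
  {r | ∃ f g, (∃ x, g x ≠ SessionType.nil V) ∧
        r = ({p | ∃ x, g x ≠ SessionType.nil V ∧ p = (f x, g x)},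
             (SessionType.inp f, SessionType.out g))} ∪
  {r | ∃ f g, (∃ x, f x ≠ SessionType.nil V) ∧
        r = ({p | ∃ x, f x ≠ SessionType.nil V ∧ p = (f x, g x)},
             (SessionType.out f, SessionType.inp g))}

/-- Corules `Ico_C` of the fair-compliance GIS (c-sync). -/
def IcoC (V : Type) : InfSys (SessionType V × SessionType V) :=
  {r | ∃ f g x, f x ≠ SessionType.nil V ∧
        r = ({(f x, g x)}, (SessionType.out f, SessionType.inp g))} ∪
  {r | ∃ f g x, g x ≠ SessionType.nil V ∧
        r = ({(f x, g x)}, (SessionType.inp f, SessionType.out g))}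

theorem Red.out_inp {V : Type} {f g : V → SessionType V} {x : V}
    (hx : f x ≠ SessionType.nil V) :
    Red (SessionType.out f, SessionType.inp g) (f x, g x) :=
  ⟨.inp x, .out f x hx, .inp g x⟩

theorem Red.inp_out {V : Type} {f g : V → SessionType V} {x : V}
    (hx : g x ≠ SessionType.nil V) :
    Red (SessionType.inp f, SessionType.out g) (f x, g x) :=
  ⟨.out x, .inp f x, .out g x hx⟩

theorem MaySucceed.of_red {V : Type} {p q : SessionType V × SessionType V}
    (hpq : Red p q) (hq : MaySucceed q) : MaySucceed p :=
  let ⟨r, hqr, hr⟩ := hq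
  ⟨r, Relation.ReflTransGen.head hpq hqr, hr⟩

theorem Ind_subset_of_closed {U : Type} {I : InfSys U} {X : Set U}
    (h : ∀ pr j, (pr, j) ∈ I → pr ⊆ X → j ∈ X) : Ind I ⊆ X :=
  OrderHom.lfp_le (infOp I) fun j ⟨pr, hpr, hr⟩ => h pr j hr hpr

/-- Derivability in `Ind (I_C ∪ Ico_C)` implies that the session may succeed. -/
theorem stmt13 {V : Type} [Nontrivial V] (R S : SessionType V)
    (h : (R, S) ∈ Ind (IC V ∪ IcoC V)) :
    MaySucceed (R, S) := by
  refine Ind_subset_of_closed (X := {p | MaySucceed p}) ?_ h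
  rintro pr j (((⟨f, T, hf, hT, hr⟩ | ⟨f, g, ⟨x, hx⟩, hr⟩) | ⟨f, g, ⟨x, hx⟩, hr⟩) |
    (⟨f, g, x, hx, hr⟩ | ⟨f, g, x, hx, hr⟩)) hpr <;> obtain ⟨rfl, rfl⟩ := Prod.mk.inj hr
  · exact ⟨_, Relation.ReflTransGen.refl, ⟨f, rfl, hf⟩, hT⟩
  · exact MaySucceed.of_red (Red.inp_out hx) (hpr ⟨x, hx, rfl⟩)
  · exact MaySucceed.of_red (Red.out_inp hx) (hpr ⟨x, hx, rfl⟩)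
  · exact MaySucceed.of_red (Red.out_inp hx) (hpr rfl)
  · exact MaySucceed.of_red (Red.inp_out hx) (hpr rfl)
end

section
/- If the session (R, S) may succeed, i.e. there exists a successful (R', S') with (R, S) ⇒ (R', S'), then (R, S) ∈ Ind(I_C ∪ Ico_C). -/
/-- `Ind I` is closed under the rules of `I`. -/
theorem Ind.of_rule {U : Type} {I : InfSys U} {pr : Set U} {j : U}
    (hr : (pr, j) ∈ I) (hpr : pr ⊆ Ind I) : j ∈ Ind I :=
  (infOp I).map_lfp.le ⟨pr, hpr, hr⟩

theorem Successful.mem_ind {V : Type} {p : SessionType V × SessionType V}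
    (h : Successful p) : p ∈ Ind (IC V ∪ IcoC V) := by
  obtain ⟨R, S⟩ := p
  obtain ⟨⟨f, rfl, hf⟩, hS⟩ := h
  exact Ind.of_rule (.inl (.inl (.inl ⟨f, S, hf, hS, rfl⟩))) (Set.empty_subset _)

/-- Derivability with corules is closed under backward reduction. -/
theorem Red.mem_ind {V : Type} {p q : SessionType V × SessionType V}
    (h : Red p q) (hq : q ∈ Ind (IC V ∪ IcoC V)) : p ∈ Ind (IC V ∪ IcoC V) := by
  obtain ⟨R, S⟩ := p
  obtain ⟨R', S'⟩ := q
  obtain ⟨α | α, hR, hS⟩ := h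
  · obtain ⟨g, x⟩ := hS
    obtain _ | ⟨f, x, hx⟩ := hR
    exact Ind.of_rule (.inr (.inl ⟨f, g, _, hx, rfl⟩)) (Set.singleton_subset_iff.2 hq)
  · obtain _ | ⟨g, x, hx⟩ := hS
    obtain ⟨f, x⟩ := hR
    exact Ind.of_rule (.inr (.inr ⟨f, g, _, hx, rfl⟩)) (Set.singleton_subset_iff.2 hq)

/-- If a session may succeed then it is derivable in `Ind (I_C ∪ Ico_C)`. -/
theorem stmt14 {V : Type} [Nontrivial V] (R S : SessionType V)
    (h : MaySucceed (R, S)) :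
    (R, S) ∈ Ind (IC V ∪ IcoC V) := by
  obtain ⟨q, hred, hq⟩ := h
  exact Relation.ReflTransGen.head_induction_on hred hq.mem_ind fun h _ ih => h.mem_ind ih
end

section
/- Consistency of fair compliance with respect to the plain rules: let FC = {(R, S) | R is fairly compliant with S}. Then FC ⊆ F_{I_C}(FC); that is, whenever R is fairly compliant with S, the pair (R, S) is the conclusion of some rule of I_C all of whose premises belong to FC. -/
theorem FairCompliant.of_red {V : Type} {R S R' S' : SessionType V}
    (h : FairCompliant R S) (hr : Red (R, S) (R', S')) : FairCompliant R' S' :=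
  fun p hp => h p (Relation.ReflTransGen.head hr hp)

/-- Consistency of fair compliance with respect to the plain rules `I_C`. -/
theorem stmt15 {V : Type} [Nontrivial V] :
    {p : SessionType V × SessionType V | FairCompliant p.1 p.2} ⊆
      infOp (IC V) {p : SessionType V × SessionType V | FairCompliant p.1 p.2} := by
  rintro ⟨R, S⟩ h
  change FairCompliant R S at h
  obtain ⟨q, hq, hs⟩ := h (R, S) .refl
  rcases Relation.ReflTransGen.cases_head hq with rfl | ⟨⟨R', S'⟩, ⟨α, hR, hS⟩, -⟩
  · obtain ⟨⟨f, rfl, hf⟩, hS⟩ := hs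
    exact ⟨∅, Set.empty_subset _, Or.inl (Or.inl ⟨f, S, hf, hS, rfl⟩)⟩
  · cases α with
    | inp x =>
      obtain _ | ⟨f, _, hx⟩ := hR
      obtain ⟨g, _⟩ := hS
      refine ⟨_, ?_, Or.inr ⟨f, g, ⟨x, hx⟩, rfl⟩⟩
      rintro _ ⟨y, hy, rfl⟩
      exact h.of_red ⟨.inp y, .out f y hy, .inp g y⟩
    | out x =>
      obtain ⟨f, _⟩ := hR
      obtain _ | ⟨g, _, hx⟩ := hS
      refine ⟨_, ?_, Or.inl (Or.inr ⟨f, g, ⟨x, hx⟩, rfl⟩)⟩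
      rintro _ ⟨y, hy, rfl⟩
      exact h.of_red ⟨.out y, .inp f y, .out g y hy⟩
end
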